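/- Let ε ∈ (0, 1/1000). There is a constant C_ε > 0 such that for all x ≥ 2, all primes q with x^{1/9+ε} ≤ q ≤ x, all z ≥ (x/q)^{1+ε}, and all quadratic nonresidues α modulo q, one has (1/φ(q)) · ∑_{ℓ ∈ (ℤ/qℤ)^×} | (1/2)·∑_{(n,c): x < nc⁶ ≤ 2x, nc⁶ ≡ ℓ or αℓ (mod q), c⁶ > z} μ(c)f(n) − (1/φ(q))·∑_{(n,c): x < nc⁶ ≤ 2x, gcd(nc⁶, q)=1, c⁶ > z} μ(c)f(n) |² ≤ C_ε · (x/q)^{1/6 − ε/16}. -/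

import Mathlib

open MeasureTheory
open scoped Classical

/-- Real value of the Riemann zeta function at a real point. -/
noncomputable def zr (s : ℝ) : ℝ := (riemannZeta (s : ℂ)).re

/-- The smooth approximant `f(u) = ζ(3/2)/(2 u^{1/2}) + ζ(2/3)/(3 u^{2/3})`. -/
noncomputable def fm (u : ℝ) : ℝ :=
  zr (3/2) / (2 * u ^ ((1:ℝ)/2)) + zr (2/3) / (3 * u ^ ((2:ℝ)/3))

/-- `W(y) = ∫_1^2 f(u) e^{-2π i u y} du`. -/
noncomputable def Wf (y : ℝ) : ℂ :=
  ∫ u in (1:ℝ)..2, (fm u : ℂ) * Complex.exp (((-2 * Real.pi * u * y : ℝ) : ℂ) * Complex.I)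

/-- The constant `C = (ζ(11/6)/2) ∏_p (1 - p⁻² + 2p⁻⁶ + 2p⁻⁷) ∫_0^∞ |W(y)|² y^{5/6} dy`. -/
noncomputable def Cmain : ℝ :=
  (zr (11/6) / 2) *
    (∏' p : Nat.Primes, (1 - 1/((p:ℕ):ℝ)^2 + 2/((p:ℕ):ℝ)^6 + 2/((p:ℕ):ℝ)^7)) *
    ∫ y in Set.Ioi (0:ℝ), ‖Wf y‖^2 * y ^ ((5:ℝ)/6)

/-- `∑_{(n,c) : x < n c⁶ ≤ 2x, P c, n c⁶ ≡ a (mod q)} μ(c) f(n)`. -/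
noncomputable def Spair (x : ℝ) (q : ℕ) (a : ZMod q) (P : ℕ → Prop) : ℝ :=
  ∑ n ∈ Finset.Icc 1 ⌊2*x⌋₊, ∑ c ∈ Finset.Icc 1 ⌊2*x⌋₊,
    if x < ((n * c^6 : ℕ) : ℝ) ∧ ((n * c^6 : ℕ) : ℝ) ≤ 2*x ∧ P c ∧
        ((n * c^6 : ℕ) : ZMod q) = a
    then ((ArithmeticFunction.moebius c : ℤ) : ℝ) * fm n else 0

/-- `∑_{(n,c) : x < n c⁶ ≤ 2x, P c, gcd(n c⁶, q) = 1} μ(c) f(n)`. -/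
noncomputable def SpairCop (x : ℝ) (q : ℕ) (P : ℕ → Prop) : ℝ :=
  ∑ n ∈ Finset.Icc 1 ⌊2*x⌋₊, ∑ c ∈ Finset.Icc 1 ⌊2*x⌋₊,
    if x < ((n * c^6 : ℕ) : ℝ) ∧ ((n * c^6 : ℕ) : ℝ) ≤ 2*x ∧ P c ∧
        Nat.Coprime (n * c^6) q
    then ((ArithmeticFunction.moebius c : ℤ) : ℝ) * fm n else 0

/-- The sixth-power residue class `c⁶ = b` modulo a prime `q` meets `[0, y]` in at most
`6 (y / q + 1)` points. -/
lemma card_le_of_pow_six_eq {q : ℕ} [Fact q.Prime] (b : ZMod q) {y : ℝ} (hy : 0 ≤ y)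
    (s : Finset ℕ) (hs : ∀ c ∈ s, (c : ℝ) ≤ y ∧ (c : ZMod q) ^ 6 = b) :
    (s.card : ℝ) ≤ 6 * (y / q + 1) := by
  classical
  have hq : 0 < q := (Fact.out : q.Prime).pos
  have hqr : (0 : ℝ) < q := by exact_mod_cast hq
  set t := (Polynomial.nthRoots 6 b).toFinset ×ˢ Finset.range (⌊y⌋₊ / q + 1) with ht
  have h1 : s.card ≤ t.card := by
    refine Finset.card_le_card_of_injOn (fun c => ((c : ZMod q), c / q)) ?_ ?_
    · intro c hc
      obtain ⟨h1, h2⟩ := hs c hc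
      simp only [ht, Finset.coe_product, Set.mem_prod, Finset.mem_coe, Multiset.mem_toFinset,
        Finset.mem_range]
      refine ⟨?_, ?_⟩
      · rw [Polynomial.mem_nthRoots (by norm_num)]
        exact h2
      · exact Nat.lt_succ_of_le (Nat.div_le_div_right (Nat.le_floor h1))
    · intro c _ d _ hcd
      simp only [Prod.mk.injEq] at hcd
      obtain ⟨h1, h2⟩ := hcd
      have h3 : c % q = d % q := (ZMod.natCast_eq_natCast_iff' c d q).1 h1
      rw [← Nat.div_add_mod c q, ← Nat.div_add_mod d q, h2, h3]
  have h2 : t.card ≤ 6 * (⌊y⌋₊ / q + 1) := by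
    rw [ht, Finset.card_product, Finset.card_range]
    exact Nat.mul_le_mul_right _
      ((Multiset.toFinset_card_le _).trans (Polynomial.card_nthRoots 6 b))
  have h3 : ((⌊y⌋₊ / q : ℕ) : ℝ) ≤ y / q :=
    Nat.cast_div_le.trans (div_le_div_of_nonneg_right (Nat.floor_le hy) hqr.le)
  have h4 : (s.card : ℝ) ≤ 6 * ((⌊y⌋₊ / q : ℕ) + 1) := by exact_mod_cast h1.trans h2
  linarith

lemma card_le_of_forall_mem_le {y : ℝ} (hy : 0 ≤ y) (s : Finset ℕ)
    (hs : ∀ c ∈ s, 1 ≤ c ∧ (c : ℝ) ≤ y) : (s.card : ℝ) ≤ y := by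
  have : s ⊆ Finset.Icc 1 ⌊y⌋₊ := fun c hc =>
    Finset.mem_Icc.2 ⟨(hs c hc).1, Nat.le_floor (hs c hc).2⟩
  have h := Finset.card_le_card this
  rw [Nat.card_Icc, Nat.add_sub_cancel] at h
  exact (Nat.cast_le.2 h).trans (Nat.floor_le hy)

lemma sum_rpow_sub_one_le {r : ℝ} (hr0 : 0 < r) (hr1 : r ≤ 1) (N : ℕ) :
    ∑ n ∈ Finset.Icc 1 N, (n : ℝ) ^ (r - 1) ≤ (N : ℝ) ^ r / r := by
  induction N with
  | zero => simp [Real.zero_rpow hr0.ne']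
  | succ k ih =>
    rw [Finset.sum_Icc_succ_top (by omega)]
    have hk : (0 : ℝ) < (k : ℝ) + 1 := by positivity
    have h1 : ((k : ℝ)) ^ r ≤ ((k : ℝ) + 1) ^ r * (1 - r / (k + 1)) := by
      have h2 : (k : ℝ) = ((k : ℝ) + 1) * (1 + -(1 / (k + 1))) := by field_simp; ring
      have h3 : (-1 : ℝ) ≤ -(1 / ((k : ℝ) + 1)) := by
        have : 1 / ((k : ℝ) + 1) ≤ 1 := by
          rw [div_le_one hk]; linarith [(Nat.cast_nonneg k : (0 : ℝ) ≤ k)]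
        linarith
      have h4 := rpow_one_add_le_one_add_mul_self h3 hr0.le hr1
      calc (k : ℝ) ^ r = (((k : ℝ) + 1) * (1 + -(1 / (k + 1)))) ^ r := by rw [← h2]
        _ = ((k : ℝ) + 1) ^ r * (1 + -(1 / ((k : ℝ) + 1))) ^ r :=
          Real.mul_rpow hk.le (by linarith)
        _ ≤ ((k : ℝ) + 1) ^ r * (1 + r * -(1 / ((k : ℝ) + 1))) := by gcongr
        _ = _ := by ring
    have h5 : ((k : ℝ) + 1) ^ (r - 1) = ((k : ℝ) + 1) ^ r / (k + 1) := Real.rpow_sub_one hk.ne' r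
    push_cast
    rw [le_div_iff₀ hr0] at ih ⊢
    rw [add_mul, h5]
    have h6 : ((k : ℝ) + 1) ^ r * (1 - r / (k + 1)) =
      ((k : ℝ) + 1) ^ r - ((k : ℝ) + 1) ^ r / (k + 1) * r := by ring
    linarith

/-- Abel's inequality for a nonnegative antitone weight. -/
lemma norm_sum_range_smul_le_of_antitone {g : ℕ → ℝ} (hg : Antitone g) (hg0 : ∀ n, 0 ≤ g n)
    {z : ℕ → ℂ} {B : ℝ} (hB : ∀ n, ‖∑ i ∈ Finset.range n, z i‖ ≤ B) (n : ℕ) :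
    ‖∑ i ∈ Finset.range n, (g i : ℂ) * z i‖ ≤ g 0 * B := by
  have key : ∀ n, ∑ i ∈ Finset.range n, (g i : ℂ) * z i =
      (g n : ℂ) * ∑ i ∈ Finset.range n, z i +
        ∑ i ∈ Finset.range n, ((g i - g (i + 1) : ℝ) : ℂ) * ∑ j ∈ Finset.range (i + 1), z j := by
    intro n
    induction n with
    | zero => simp
    | succ k ih =>
      rw [Finset.sum_range_succ, ih, Finset.sum_range_succ (fun i => ((g i - g (i + 1) : ℝ) : ℂ) *
        ∑ j ∈ Finset.range (i + 1), z j) k, Finset.sum_range_succ z k]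
      push_cast
      ring
  rw [key]
  have hB0 : 0 ≤ B := (norm_nonneg _).trans (hB 0)
  calc _ ≤ ‖(g n : ℂ) * ∑ i ∈ Finset.range n, z i‖ + ∑ i ∈ Finset.range n,
        ‖((g i - g (i + 1) : ℝ) : ℂ) * ∑ j ∈ Finset.range (i + 1), z j‖ :=
        (norm_add_le _ _).trans (add_le_add_right (norm_sum_le _ _) _)
    _ ≤ g n * B + ∑ i ∈ Finset.range n, (g i - g (i + 1)) * B := by
        refine add_le_add ?_ (Finset.sum_le_sum fun i _ => ?_)
        · rw [norm_mul, Complex.norm_real, Real.norm_of_nonneg (hg0 n)]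
          exact mul_le_mul_of_nonneg_left (hB n) (hg0 n)
        · have h := sub_nonneg.2 (hg (Nat.le_succ i))
          rw [norm_mul, Complex.norm_real, Real.norm_of_nonneg h]
          exact mul_le_mul_of_nonneg_left (hB _) h
    _ = g 0 * B := by
        rw [← Finset.sum_mul, Finset.sum_range_sub']
        ring

lemma norm_geom_sum_le_of_norm_eq_one {ζ : ℂ} (h1 : ‖ζ‖ = 1) (hne : ζ ≠ 1) (n : ℕ) :
    ‖∑ i ∈ Finset.range n, ζ ^ i‖ ≤ 2 * ‖1 - ζ‖⁻¹ := by
  rw [geom_sum_eq hne, norm_div, norm_sub_rev ζ 1, div_eq_mul_inv]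
  gcongr
  calc ‖ζ ^ n - 1‖ ≤ ‖ζ ^ n‖ + ‖(1 : ℂ)‖ := norm_sub_le _ _
    _ = 2 := by rw [norm_pow, h1]; norm_num

lemma norm_sum_Ioc_rpow_mul_pow_le {s : ℝ} (hs : 1 / 2 ≤ s) {R : ℝ} (hR : 0 < R) {a b : ℕ}
    (ha : R ≤ (a : ℝ) + 1) {ζ : ℂ} (h1 : ‖ζ‖ = 1) (hne : ζ ≠ 1) :
    ‖∑ n ∈ Finset.Ioc a b, (((n : ℝ) ^ (-s) : ℝ) : ℂ) * ζ ^ n‖ ≤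
      R ^ (-(1 / 2) : ℝ) * (2 * ‖1 - ζ‖⁻¹) := by
  have hreindex : ∑ n ∈ Finset.Ioc a b, (((n : ℝ) ^ (-s) : ℝ) : ℂ) * ζ ^ n =
      ζ ^ (a + 1) * ∑ i ∈ Finset.range (b - a),
        (((((a + 1 + i : ℕ) : ℝ)) ^ (-s) : ℝ) : ℂ) * ζ ^ i := by
    rw [← Finset.Ico_add_one_add_one_eq_Ioc, Finset.sum_Ico_eq_sum_range, Finset.mul_sum,
      Nat.add_sub_add_right]
    refine Finset.sum_congr rfl fun i _ => ?_
    rw [pow_add]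
    ring
  rw [hreindex, norm_mul, norm_pow, h1, one_pow, one_mul]
  have ha1 : (1 : ℝ) ≤ (a : ℝ) + 1 := by linarith [(Nat.cast_nonneg a : (0 : ℝ) ≤ a)]
  have hanti : Antitone fun i : ℕ => (((a + 1 + i : ℕ) : ℝ)) ^ (-s) := by
    intro i j hij
    refine Real.rpow_le_rpow_of_nonpos (by positivity) ?_ (by linarith)
    exact_mod_cast Nat.add_le_add_left hij _
  refine (norm_sum_range_smul_le_of_antitone hanti (fun i => by positivity)
    (norm_geom_sum_le_of_norm_eq_one h1 hne) _).trans ?_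
  refine mul_le_mul_of_nonneg_right ?_ (by positivity)
  push_cast
  rw [add_zero]
  calc ((a : ℝ) + 1) ^ (-s) ≤ ((a : ℝ) + 1) ^ (-(1 / 2) : ℝ) :=
        Real.rpow_le_rpow_of_exponent_le ha1 (by linarith)
    _ ≤ R ^ (-(1 / 2) : ℝ) := Real.rpow_le_rpow_of_nonpos hR ha (by norm_num)

lemma sum_sq_le_mul_of_le {ι : Type*} (s : Finset ι) {f : ι → ℝ} {B D : ℝ}
    (h0 : ∀ i ∈ s, 0 ≤ f i) (hB : ∀ i ∈ s, f i ≤ B) (hB0 : 0 ≤ B) (hD : ∑ i ∈ s, f i ≤ D) :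
    ∑ i ∈ s, f i ^ 2 ≤ B * D :=
  calc ∑ i ∈ s, f i ^ 2 ≤ ∑ i ∈ s, B * f i := Finset.sum_le_sum fun i hi => by
        rw [sq]; exact mul_le_mul_of_nonneg_right (hB i hi) (h0 i hi)
    _ = B * ∑ i ∈ s, f i := (Finset.mul_sum _ _ _).symm
    _ ≤ B * D := mul_le_mul_of_nonneg_left hD hB0

/-- A constant for the pointwise bound of the smooth approximant. -/
noncomputable def fmBound : ℝ := |zr (3/2)| + |zr (2/3)|

lemma fmBound_nonneg : 0 ≤ fmBound := by unfold fmBound; positivity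

lemma fm_eq (n : ℕ) : fm n =
    zr (3/2) / 2 * (n : ℝ) ^ (-(1 / 2) : ℝ) + zr (2/3) / 3 * (n : ℝ) ^ (-(2 / 3) : ℝ) := by
  unfold fm
  rw [Real.rpow_neg (Nat.cast_nonneg n), Real.rpow_neg (Nat.cast_nonneg n)]
  simp only [div_eq_mul_inv, mul_inv]
  ring

lemma abs_fm_le {n : ℕ} (hn : 1 ≤ n) : |fm n| ≤ fmBound * (n : ℝ) ^ (-(1 / 2) : ℝ) := by
  have hn1 : (1 : ℝ) ≤ n := by exact_mod_cast hn
  have h : (n : ℝ) ^ (-(2 / 3) : ℝ) ≤ (n : ℝ) ^ (-(1 / 2) : ℝ) :=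
    Real.rpow_le_rpow_of_exponent_le hn1 (by norm_num)
  have h0 : 0 ≤ (n : ℝ) ^ (-(2 / 3) : ℝ) := by positivity
  rw [fm_eq]
  refine (abs_add_le _ _).trans ?_
  rw [abs_mul, abs_mul, abs_div, abs_div, abs_of_nonneg h0, abs_of_nonneg (h0.trans h), fmBound]
  norm_num
  nlinarith [abs_nonneg (zr (3/2)), abs_nonneg (zr (2/3)),
    mul_nonneg (abs_nonneg (zr (3/2))) (h0.trans h), mul_nonneg (abs_nonneg (zr (2/3))) h0,
    mul_le_mul_of_nonneg_left h (abs_nonneg (zr (2/3)))]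

lemma norm_sum_Ioc_fm_mul_pow_le {R : ℝ} (hR : 0 < R) {a b : ℕ}
    (ha : R ≤ (a : ℝ) + 1) {ζ : ℂ} (h1 : ‖ζ‖ = 1) (hne : ζ ≠ 1) :
    ‖∑ n ∈ Finset.Ioc a b, (fm n : ℂ) * ζ ^ n‖ ≤
      2 * fmBound * R ^ (-(1 / 2) : ℝ) * ‖1 - ζ‖⁻¹ := by
  have hsplit : ∑ n ∈ Finset.Ioc a b, (fm n : ℂ) * ζ ^ n =
      ((zr (3/2) / 2 : ℝ) : ℂ) *
        ∑ n ∈ Finset.Ioc a b, (((n : ℝ) ^ (-(1 / 2) : ℝ) : ℝ) : ℂ) * ζ ^ n +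
      ((zr (2/3) / 3 : ℝ) : ℂ) *
        ∑ n ∈ Finset.Ioc a b, (((n : ℝ) ^ (-(2 / 3) : ℝ) : ℝ) : ℂ) * ζ ^ n := by
    rw [Finset.mul_sum, Finset.mul_sum, ← Finset.sum_add_distrib]
    refine Finset.sum_congr rfl fun n _ => ?_
    rw [fm_eq]
    push_cast
    ring
  have e1 := norm_sum_Ioc_rpow_mul_pow_le (s := 1 / 2) le_rfl hR (b := b) ha h1 hne
  have e2 := norm_sum_Ioc_rpow_mul_pow_le (s := 2 / 3) (by norm_num) hR (b := b) ha h1 hne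
  rw [hsplit]
  refine (norm_add_le _ _).trans ?_
  rw [norm_mul, norm_mul, Complex.norm_real, Complex.norm_real, Real.norm_eq_abs,
    Real.norm_eq_abs, abs_div, abs_div]
  set T := R ^ (-(1 / 2) : ℝ) * (2 * ‖1 - ζ‖⁻¹) with hT
  have hT0 : 0 ≤ T := by positivity
  calc _ ≤ |zr (3/2)| * T + |zr (2/3)| * T := by
        have i1 : |zr (3/2)| / |(2 : ℝ)| ≤ |zr (3/2)| := by
          rw [abs_two]; linarith [abs_nonneg (zr (3/2))]
        have i2 : |zr (2/3)| / |(3 : ℝ)| ≤ |zr (2/3)| := by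
          rw [abs_of_pos (by norm_num : (0 : ℝ) < 3)]; linarith [abs_nonneg (zr (2/3))]
        gcongr
    _ = _ := by rw [hT, fmBound]; ring

lemma norm_stdAddChar_eq_one {q : ℕ} [NeZero q] (h : ZMod q) : ‖ZMod.stdAddChar h‖ = 1 := by
  rw [ZMod.stdAddChar_apply]
  exact Circle.norm_coe _

lemma stdAddChar_ne_one {q : ℕ} [NeZero q] {h : ZMod q} (hh : h ≠ 0) :
    ZMod.stdAddChar h ≠ 1 := by
  rw [← AddChar.map_zero_eq_one (ZMod.stdAddChar (N := q))]
  exact fun e => hh (ZMod.injective_stdAddChar e)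

lemma norm_one_sub_stdAddChar {q : ℕ} [NeZero q] (h : ZMod q) :
    ‖1 - ZMod.stdAddChar h‖ = 2 * Real.sin (Real.pi * h.val / q) := by
  have hq : (0 : ℝ) < q := by exact_mod_cast NeZero.pos q
  have hle : (h.val : ℝ) ≤ q := by exact_mod_cast (ZMod.val_lt h).le
  have h1 : ZMod.stdAddChar h = Complex.exp (Complex.I * ((2 * Real.pi * h.val / q : ℝ) : ℂ)) := by
    have h2 : h = (((h.val : ℕ) : ℤ) : ZMod q) := by simp
    conv_lhs => rw [h2]
    rw [ZMod.stdAddChar_coe]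
    congr 1
    push_cast
    ring
  rw [h1, norm_sub_rev, Complex.norm_exp_I_mul_ofReal_sub_one, Real.norm_of_nonneg]
  · congr 2
    ring
  · refine mul_nonneg zero_le_two (Real.sin_nonneg_of_nonneg_of_le_pi (by positivity) ?_)
    rw [div_div, div_le_iff₀ (by positivity)]
    nlinarith [Real.pi_pos]

lemma inv_norm_one_sub_stdAddChar_le {q : ℕ} [NeZero q] {h : ZMod q} (hh : h ≠ 0) :
    ‖1 - ZMod.stdAddChar h‖⁻¹ ≤ q / 4 * ((h.val : ℝ)⁻¹ + ((-h).val : ℝ)⁻¹) := by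
  have hq : (0 : ℝ) < q := by exact_mod_cast NeZero.pos q
  have hlt : (h.val : ℝ) < q := by exact_mod_cast ZMod.val_lt h
  have hpos : (0 : ℝ) < h.val := by
    exact_mod_cast Nat.pos_of_ne_zero fun e => hh ((ZMod.val_eq_zero h).1 e)
  have hneg : ((-h).val : ℝ) = q - h.val := by
    have : NeZero h := ⟨hh⟩
    rw [ZMod.val_neg_of_ne_zero, Nat.cast_sub (ZMod.val_lt h).le]
  have hpi := Real.pi_pos
  have key : ∀ t : ℝ, 0 < t → t ≤ q / 2 → 4 * t / q ≤ 2 * Real.sin (Real.pi * t / q) := by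
    intro t ht0 ht
    have h1 := Real.mul_le_sin (x := Real.pi * t / q) (by positivity) (by
      rw [div_le_div_iff₀ hq two_pos]; nlinarith)
    have h2 : 2 / Real.pi * (Real.pi * t / q) = 2 * t / q := by field_simp
    rw [h2] at h1
    calc 4 * t / q = 2 * (2 * t / q) := by ring
      _ ≤ _ := by linarith
  have hinv : ∀ t : ℝ, 0 < t → (4 * t / q)⁻¹ = q / 4 * t⁻¹ := by
    intro t ht; field_simp
  rw [norm_one_sub_stdAddChar, hneg]
  have hpos' : (0 : ℝ) < q - h.val := by linarith
  rcases le_total (h.val : ℝ) (q / 2) with hc | hc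
  · calc _ ≤ (4 * (h.val : ℝ) / q)⁻¹ := inv_anti₀ (by positivity) (key _ hpos hc)
      _ = q / 4 * (h.val : ℝ)⁻¹ := hinv _ hpos
      _ ≤ _ := by
        gcongr
        exact le_add_of_nonneg_right (by positivity)
  · have hs : Real.sin (Real.pi * h.val / q) = Real.sin (Real.pi * (q - h.val) / q) := by
      rw [← Real.sin_pi_sub]
      congr 1
      field_simp
    rw [hs]
    calc _ ≤ (4 * ((q : ℝ) - h.val) / q)⁻¹ :=
          inv_anti₀ (by positivity) (key _ hpos' (by linarith))
      _ = q / 4 * ((q : ℝ) - h.val)⁻¹ := hinv _ hpos'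
      _ ≤ _ := by
        gcongr
        exact le_add_of_nonneg_left (by positivity)

lemma sum_inv_norm_one_sub_stdAddChar_le (q : ℕ) [NeZero q] :
    ∑ h : ZMod q with h ≠ 0, ‖1 - ZMod.stdAddChar h‖⁻¹ ≤ q * (1 + Real.log q) := by
  have hq : (0 : ℝ) < q := by exact_mod_cast NeZero.pos q
  have h1 : ∑ h : ZMod q with h ≠ 0, (h.val : ℝ)⁻¹ ≤ 1 + Real.log q := by
    refine le_trans ?_ (harmonic_le_one_add_log q)
    rw [harmonic_eq_sum_Icc]
    push_cast
    rw [← Finset.sum_image (f := fun i : ℕ => ((i : ℝ))⁻¹)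
      ((ZMod.val_injective q).injOn)]
    refine Finset.sum_le_sum_of_subset_of_nonneg ?_ fun i _ _ => by positivity
    intro i hi
    obtain ⟨h, hh, rfl⟩ := Finset.mem_image.1 hi
    have hh0 := (Finset.mem_filter.1 hh).2
    exact Finset.mem_Icc.2 ⟨Nat.pos_of_ne_zero fun e => hh0 ((ZMod.val_eq_zero h).1 e),
      (ZMod.val_lt h).le⟩
  have h2 : ∑ h : ZMod q with h ≠ 0, ((-h).val : ℝ)⁻¹ =
      ∑ h : ZMod q with h ≠ 0, (h.val : ℝ)⁻¹ :=
    Finset.sum_nbij' (fun h => -h) (fun h => -h) (by simp) (by simp) (by simp) (by simp) (by simp)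
  have hlog : 0 ≤ 1 + Real.log q := by
    have := Real.log_natCast_nonneg q; linarith
  calc _ ≤ ∑ h : ZMod q with h ≠ 0, (q : ℝ) / 4 * ((h.val : ℝ)⁻¹ + ((-h).val : ℝ)⁻¹) :=
        Finset.sum_le_sum fun h hh => inv_norm_one_sub_stdAddChar_le (Finset.mem_filter.1 hh).2
    _ ≤ (q : ℝ) / 4 * ((1 + Real.log q) + (1 + Real.log q)) := by
        rw [← Finset.mul_sum, Finset.sum_add_distrib, h2]
        gcongr
    _ ≤ _ := by nlinarith [mul_nonneg hq.le hlog]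

lemma sum_norm_sq_sum_mul_stdAddChar {q : ℕ} [NeZero q] (w : ZMod q → ℂ) :
    ∑ a : ZMod q, ‖∑ r, w r * ZMod.stdAddChar (r * a)‖ ^ 2 = q * ∑ r, ‖w r‖ ^ 2 := by
  have hconj : ∀ r : ZMod q, (starRingEnd ℂ) (ZMod.stdAddChar r) = ZMod.stdAddChar (-r) := by
    intro r
    rw [AddChar.map_neg_eq_inv, Complex.inv_eq_conj (norm_stdAddChar_eq_one r)]
  have hC : ((∑ a : ZMod q, ‖∑ r, w r * ZMod.stdAddChar (r * a)‖ ^ 2 : ℝ) : ℂ) =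
      ((q * ∑ r, ‖w r‖ ^ 2 : ℝ) : ℂ) := by
    push_cast
    simp only [← Complex.mul_conj', map_sum, map_mul, hconj, Finset.sum_mul_sum]
    rw [Finset.sum_comm, Finset.mul_sum]
    refine Finset.sum_congr rfl fun r _ => ?_
    rw [Finset.sum_comm]
    have h1 : ∀ s : ZMod q, ∑ a : ZMod q, w r * ZMod.stdAddChar (r * a) *
        ((starRingEnd ℂ) (w s) * ZMod.stdAddChar (-(s * a))) =
        if s = r then (q : ℂ) * (w r * (starRingEnd ℂ) (w r)) else 0 := by
      intro s
      have h2 : ∀ a : ZMod q, w r * ZMod.stdAddChar (r * a) *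
          ((starRingEnd ℂ) (w s) * ZMod.stdAddChar (-(s * a))) =
          w r * (starRingEnd ℂ) (w s) * ZMod.stdAddChar (a * (r - s)) := by
        intro a
        rw [show a * (r - s) = r * a + -(s * a) by ring, AddChar.map_add_eq_mul]
        ring
      simp only [h2]
      rw [← Finset.mul_sum, AddChar.sum_mulShift _ (ZMod.isPrimitive_stdAddChar q), ZMod.card]
      by_cases hs : s = r
      · subst hs; simp; ring
      · rw [if_neg hs, if_neg (sub_ne_zero.2 (Ne.symm hs))]; simp
    simp only [h1]
    simp
  exact_mod_cast hC

lemma mem_Ioc_floor_div_iff {x : ℝ} (hx : 0 ≤ x) {c : ℕ} (hc : 1 ≤ c) (n : ℕ) :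
    n ∈ Finset.Ioc ⌊x / (c : ℝ) ^ 6⌋₊ ⌊2 * x / (c : ℝ) ^ 6⌋₊ ↔
      x < ((n * c ^ 6 : ℕ) : ℝ) ∧ ((n * c ^ 6 : ℕ) : ℝ) ≤ 2 * x := by
  have hc6 : (0 : ℝ) < (c : ℝ) ^ 6 := by
    have : (0 : ℝ) < c := by exact_mod_cast hc
    positivity
  rw [Finset.mem_Ioc, Nat.floor_lt (by positivity), Nat.le_floor_iff (by positivity),
    div_lt_iff₀ hc6, le_div_iff₀ hc6]
  push_cast
  rfl

lemma Spair_eq_sum_Ioc {q : ℕ} [Fact q.Prime] {x : ℝ} (hx : 0 < x) (P : ℕ → Prop)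
    {a : ZMod q} (ha : a ≠ 0) :
    Spair x q a P = ∑ c ∈ Finset.Icc 1 ⌊2 * x⌋₊ with P c ∧ (c : ZMod q) ≠ 0,
      ∑ n ∈ Finset.Ioc ⌊x / (c : ℝ) ^ 6⌋₊ ⌊2 * x / (c : ℝ) ^ 6⌋₊,
        if (n : ZMod q) * (c : ZMod q) ^ 6 = a then
          ((ArithmeticFunction.moebius c : ℤ) : ℝ) * fm n else 0 := by
  unfold Spair
  rw [Finset.sum_comm, Finset.sum_filter]
  refine Finset.sum_congr rfl fun c hc => ?_
  have hc1 := (Finset.mem_Icc.1 hc).1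
  split_ifs with h
  · rw [← Finset.sum_filter, ← Finset.sum_filter]
    refine Finset.sum_congr ?_ fun _ _ => rfl
    ext n
    rw [Finset.mem_filter, Finset.mem_filter, mem_Ioc_floor_div_iff hx.le hc1]
    push_cast
    constructor
    · rintro ⟨_, h1, h2, _, h3⟩
      exact ⟨⟨h1, h2⟩, h3⟩
    · rintro ⟨⟨h1, h2⟩, h3⟩
      refine ⟨?_, h1, h2, h.1, h3⟩
      have hc6 : (1 : ℝ) ≤ (c : ℝ) ^ 6 := one_le_pow₀ (by exact_mod_cast hc1)
      refine Finset.mem_Icc.2 ⟨Nat.pos_of_ne_zero ?_, Nat.le_floor ?_⟩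
      · rintro rfl
        simp at h1
        linarith
      · exact (le_mul_of_one_le_right (Nat.cast_nonneg n) hc6).trans h2
  · refine Finset.sum_eq_zero fun n _ => if_neg ?_
    rintro ⟨_, _, h3, h4⟩
    refine h ⟨h3, fun h5 => ha ?_⟩
    rw [← h4]
    push_cast
    rw [h5]
    simp

/-- The Fourier coefficient at `r` of `a ↦ Spair x q a P`, restricted to `c` prime to `q`. -/
noncomputable def pairCoeff (x : ℝ) (q : ℕ) [NeZero q] (P : ℕ → Prop) (r : ZMod q) : ℂ :=
  (q : ℂ)⁻¹ * ∑ c ∈ Finset.Icc 1 ⌊2 * x⌋₊ with P c ∧ (c : ZMod q) ≠ 0,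
    ((ArithmeticFunction.moebius c : ℤ) : ℂ) *
      ∑ n ∈ Finset.Ioc ⌊x / (c : ℝ) ^ 6⌋₊ ⌊2 * x / (c : ℝ) ^ 6⌋₊,
        (fm n : ℂ) * ZMod.stdAddChar (-(r * (c : ZMod q) ^ 6)) ^ n

lemma ofReal_Spair_eq_sum_pairCoeff {q : ℕ} [Fact q.Prime] {x : ℝ} (hx : 0 < x)
    (P : ℕ → Prop) {a : ZMod q} (ha : a ≠ 0) :
    (Spair x q a P : ℂ) = ∑ r, pairCoeff x q P r * ZMod.stdAddChar (r * a) := by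
  have hq : (q : ℂ) ≠ 0 := by exact_mod_cast (Fact.out : q.Prime).ne_zero
  rw [Spair_eq_sum_Ioc hx P ha]
  unfold pairCoeff
  simp only [Finset.mul_sum, Finset.sum_mul]
  rw [Finset.sum_comm]
  push_cast
  refine Finset.sum_congr rfl fun c _ => ?_
  rw [Finset.sum_comm]
  refine Finset.sum_congr rfl fun n _ => ?_
  have h1 : ∀ r : ZMod q, (q : ℂ)⁻¹ * (((ArithmeticFunction.moebius c : ℤ) : ℂ) *
      ((fm n : ℂ) * ZMod.stdAddChar (-(r * (c : ZMod q) ^ 6)) ^ n)) *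
      ZMod.stdAddChar (r * a) = (q : ℂ)⁻¹ * ((ArithmeticFunction.moebius c : ℤ) : ℂ) *
        (fm n : ℂ) * ZMod.stdAddChar (r * (a - (n : ZMod q) * (c : ZMod q) ^ 6)) := by
    intro r
    rw [show r * (a - (n : ZMod q) * (c : ZMod q) ^ 6) = n • (-(r * (c : ZMod q) ^ 6)) + r * a by
      rw [nsmul_eq_mul]; ring, AddChar.map_add_eq_mul, AddChar.map_nsmul_eq_pow]
    ring
  simp only [h1]
  rw [← Finset.mul_sum, AddChar.sum_mulShift _ (ZMod.isPrimitive_stdAddChar q), ZMod.card]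
  by_cases h : (n : ZMod q) * (c : ZMod q) ^ 6 = a
  · rw [if_pos h, if_pos (by rw [h, sub_self])]
    push_cast
    field_simp
  · rw [if_neg h, if_neg (fun e => h (sub_eq_zero.1 e).symm)]
    simp

lemma norm_moebius_le_one (c : ℕ) : ‖((ArithmeticFunction.moebius c : ℤ) : ℂ)‖ ≤ 1 := by
  rw [Complex.norm_intCast]
  exact_mod_cast ArithmeticFunction.abs_moebius_le_one

lemma norm_pairCoeff_le {q : ℕ} [Fact q.Prime] {x R : ℝ} (hR : 0 < R)
    (P : ℕ → Prop) (hP : ∀ c, P c → (c : ℝ) ^ 6 ≤ x / R) {r : ZMod q} (hr : r ≠ 0) :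
    ‖pairCoeff x q P r‖ ≤ 2 * fmBound * R ^ (-(1 / 2) : ℝ) / q *
      ∑ c ∈ Finset.Icc 1 ⌊2 * x⌋₊ with P c ∧ (c : ZMod q) ≠ 0,
        ‖1 - ZMod.stdAddChar (-(r * (c : ZMod q) ^ 6))‖⁻¹ := by
  unfold pairCoeff
  rw [norm_mul, norm_inv, Complex.norm_natCast, div_eq_inv_mul, mul_assoc]
  refine mul_le_mul_of_nonneg_left ((norm_sum_le _ _).trans ?_) (by positivity)
  rw [Finset.mul_sum]
  refine Finset.sum_le_sum fun c hc => ?_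
  obtain ⟨hc1, hPc, hcq⟩ := Finset.mem_filter.1 hc
  have hc0 : (0 : ℝ) < c := by exact_mod_cast (Finset.mem_Icc.1 hc1).1
  rw [norm_mul]
  refine (mul_le_of_le_one_left (norm_nonneg _) (norm_moebius_le_one c)).trans ?_
  refine norm_sum_Ioc_fm_mul_pow_le hR ?_ (norm_stdAddChar_eq_one _)
    (stdAddChar_ne_one (neg_ne_zero.2 (mul_ne_zero hr (pow_ne_zero 6 hcq))))
  have h1 : R ≤ x / (c : ℝ) ^ 6 := by
    rw [le_div_iff₀ (by positivity), mul_comm, ← le_div_iff₀ hR]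
    exact hP c hPc
  exact h1.trans (Nat.lt_floor_add_one _).le

lemma le_rpow_one_sixth {t y : ℝ} (ht : 0 ≤ t) (h : t ^ 6 ≤ y) : t ≤ y ^ ((1 : ℝ) / 6) := by
  calc t = (t ^ 6) ^ ((1 : ℝ) / 6) := by
        rw [← Real.rpow_natCast, ← Real.rpow_mul ht]; norm_num
    _ ≤ _ := Real.rpow_le_rpow (by positivity) h (by norm_num)

lemma sum_norm_sq_pairCoeff_le {q : ℕ} [Fact q.Prime] {x R : ℝ} (hx : 0 < x) (hR : 0 < R)
    (P : ℕ → Prop) (hP : ∀ c, P c → (c : ℝ) ^ 6 ≤ x / R) :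
    ∑ r : ZMod q with r ≠ 0, ‖pairCoeff x q P r‖ ^ 2 ≤
      24 * fmBound ^ 2 * R⁻¹ * (1 + Real.log q) ^ 2 *
        ((x / R) ^ ((1 : ℝ) / 6) * ((x / R) ^ ((1 : ℝ) / 6) / q + 1)) := by
  have hq : (0 : ℝ) < q := by exact_mod_cast (Fact.out : q.Prime).pos
  set Y := (x / R) ^ ((1 : ℝ) / 6) with hY
  have hY0 : 0 ≤ Y := by positivity
  have hL : 0 ≤ 1 + Real.log q := by have := Real.log_natCast_nonneg q; linarith
  set Cs := {c ∈ Finset.Icc 1 ⌊2 * x⌋₊ | P c ∧ (c : ZMod q) ≠ 0} with hCs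
  set m : ZMod q → ℝ := fun h => ‖1 - ZMod.stdAddChar h‖⁻¹ with hm
  have hm0 : ∀ h, 0 ≤ m h := fun h => by positivity
  have hmsum : ∑ h : ZMod q with h ≠ 0, m h ≤ q * (1 + Real.log q) :=
    sum_inv_norm_one_sub_stdAddChar_le q
  set D := 2 * fmBound * R ^ (-(1 / 2) : ℝ) / q with hD
  have hD0 : 0 ≤ D := by have := fmBound_nonneg; positivity
  have hCs_le : ∀ c ∈ Cs, 1 ≤ c ∧ (c : ℝ) ≤ Y ∧ (c : ZMod q) ≠ 0 := by
    intro c hc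
    obtain ⟨hc1, hPc, hcq⟩ := Finset.mem_filter.1 hc
    exact ⟨(Finset.mem_Icc.1 hc1).1, le_rpow_one_sixth (Nat.cast_nonneg c) (hP c hPc), hcq⟩
  have hw : ∀ r : ZMod q, r ≠ 0 →
      ‖pairCoeff x q P r‖ ≤ D * ∑ c ∈ Cs, m (-(r * (c : ZMod q) ^ 6)) :=
    fun r hr => norm_pairCoeff_le hR P hP hr
  have hpoint : ∀ r : ZMod q, r ≠ 0 →
      ∑ c ∈ Cs, m (-(r * (c : ZMod q) ^ 6)) ≤ 6 * (Y / q + 1) * (q * (1 + Real.log q)) := by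
    intro r hr
    have hmaps : ∀ c ∈ Cs, -(r * (c : ZMod q) ^ 6) ∈ ({h | h ≠ 0} : Finset (ZMod q)) := by
      intro c hc
      simpa using ⟨hr, (hCs_le c hc).2.2⟩
    rw [← Finset.sum_fiberwise_of_maps_to hmaps]
    calc _ ≤ ∑ h : ZMod q with h ≠ 0, 6 * (Y / q + 1) * m h := by
          refine Finset.sum_le_sum fun h _ => ?_
          rw [Finset.sum_congr rfl fun c hc => by rw [(Finset.mem_filter.1 hc).2],
            Finset.sum_const, nsmul_eq_mul]
          refine mul_le_mul_of_nonneg_right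
            (card_le_of_pow_six_eq (-(r⁻¹ * h)) hY0 _ fun c hc => ?_) (hm0 h)
          obtain ⟨hc1, hc2⟩ := Finset.mem_filter.1 hc
          refine ⟨(hCs_le c hc1).2.1, ?_⟩
          rw [← hc2, mul_neg, neg_neg, inv_mul_cancel_left₀ hr]
      _ ≤ _ := by
          rw [← Finset.mul_sum]
          exact mul_le_mul_of_nonneg_left hmsum (by positivity)
  have htotal : ∑ r : ZMod q with r ≠ 0, ∑ c ∈ Cs, m (-(r * (c : ZMod q) ^ 6)) ≤
      Y * (q * (1 + Real.log q)) := by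
    rw [Finset.sum_comm]
    calc _ ≤ ∑ _c ∈ Cs, (q : ℝ) * (1 + Real.log q) := by
          refine Finset.sum_le_sum fun c hc => le_of_eq_of_le ?_ hmsum
          have hcq := (hCs_le c hc).2.2
          refine Finset.sum_nbij' (fun r => -(r * (c : ZMod q) ^ 6))
            (fun h => -h * ((c : ZMod q) ^ 6)⁻¹) ?_ ?_ ?_ ?_ ?_
          · intro r hr; simpa [hcq] using hr
          · intro h hh; simpa [hcq] using hh
          · intro r _; field_simp
          · intro h _; field_simp
          · intro r _; rfl
      _ ≤ _ := by
          rw [Finset.sum_const, nsmul_eq_mul]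
          refine mul_le_mul_of_nonneg_right (card_le_of_forall_mem_le hY0 Cs fun c hc =>
            ⟨(hCs_le c hc).1, (hCs_le c hc).2.1⟩) (by positivity)
  have hR2 : (R ^ (-(1 / 2) : ℝ)) ^ 2 = R⁻¹ := by
    rw [← Real.rpow_natCast, ← Real.rpow_mul hR.le, ← Real.rpow_neg_one]; norm_num
  calc ∑ r : ZMod q with r ≠ 0, ‖pairCoeff x q P r‖ ^ 2
      ≤ (D * (6 * (Y / q + 1) * (q * (1 + Real.log q)))) * (D * (Y * (q * (1 + Real.log q)))) := by
        refine sum_sq_le_mul_of_le _ (fun r _ => norm_nonneg _) (fun r hr => ?_) (by positivity) ?_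
        · have hr0 := (Finset.mem_filter.1 hr).2
          exact (hw r hr0).trans (mul_le_mul_of_nonneg_left (hpoint r hr0) hD0)
        · refine (Finset.sum_le_sum fun r hr => hw r (Finset.mem_filter.1 hr).2).trans ?_
          rw [← Finset.mul_sum]
          exact mul_le_mul_of_nonneg_left htotal hD0
    _ = 24 * fmBound ^ 2 * (R ^ (-(1 / 2) : ℝ)) ^ 2 * (1 + Real.log q) ^ 2 *
        (Y * (Y / q + 1)) := by
        rw [hD]
        field_simp
        ring
    _ = _ := by rw [hR2]

/-- Variance bound for the pairs with `c` small, by Fourier analysis on `ℤ/q`. -/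
lemma exists_sum_sq_Spair_sub_le {q : ℕ} [Fact q.Prime] {x R : ℝ} (hx : 0 < x) (hR : 0 < R)
    (P : ℕ → Prop) (hP : ∀ c, P c → (c : ℝ) ^ 6 ≤ x / R) :
    ∃ k : ℝ, ∑ a : ZMod q with a ≠ 0, (Spair x q a P - k) ^ 2 ≤
      q * (24 * fmBound ^ 2 * R⁻¹ * (1 + Real.log q) ^ 2 *
        ((x / R) ^ ((1 : ℝ) / 6) * ((x / R) ^ ((1 : ℝ) / 6) / q + 1))) := by
  classical
  refine ⟨(pairCoeff x q P 0).re, ?_⟩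
  set w : ZMod q → ℂ := fun r => if r = 0 then 0 else pairCoeff x q P r with hw
  have h1 : ∀ a : ZMod q, a ≠ 0 → (Spair x q a P - (pairCoeff x q P 0).re) ^ 2 ≤
      ‖∑ r, w r * ZMod.stdAddChar (r * a)‖ ^ 2 := by
    intro a ha
    have h2 : ∑ r, w r * ZMod.stdAddChar (r * a) = (Spair x q a P : ℂ) - pairCoeff x q P 0 := by
      rw [ofReal_Spair_eq_sum_pairCoeff hx P ha, ← Finset.add_sum_erase _ _ (Finset.mem_univ 0),
        ← Finset.add_sum_erase _ (fun r => pairCoeff x q P r * _) (Finset.mem_univ 0)]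
      simp only [hw, if_true, zero_mul, zero_add, AddChar.map_zero_eq_one, mul_one,
        add_sub_cancel_left]
      exact Finset.sum_congr rfl fun r hr => by rw [if_neg (Finset.ne_of_mem_erase hr)]
    have h3 : (Spair x q a P - (pairCoeff x q P 0).re) =
        ((Spair x q a P : ℂ) - pairCoeff x q P 0).re := by simp
    rw [h2, h3, ← sq_abs]
    gcongr
    exact Complex.abs_re_le_norm _
  calc _ ≤ ∑ a : ZMod q with a ≠ 0, ‖∑ r, w r * ZMod.stdAddChar (r * a)‖ ^ 2 :=
        Finset.sum_le_sum fun a ha => h1 a (Finset.mem_filter.1 ha).2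
    _ ≤ ∑ a : ZMod q, ‖∑ r, w r * ZMod.stdAddChar (r * a)‖ ^ 2 :=
        Finset.sum_le_sum_of_subset_of_nonneg (Finset.filter_subset _ _)
          fun _ _ _ => by positivity
    _ = q * ∑ r : ZMod q with r ≠ 0, ‖pairCoeff x q P r‖ ^ 2 := by
        rw [sum_norm_sq_sum_mul_stdAddChar, Finset.sum_filter]
        congr 1
        refine Finset.sum_congr rfl fun r _ => ?_
        by_cases hr : r = 0 <;> simp [hw, hr]
    _ ≤ _ := mul_le_mul_of_nonneg_left (sum_norm_sq_pairCoeff_le hx hR P hP) (Nat.cast_nonneg q)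

lemma rpow_neg_half_mul_rpow_div {x : ℝ} (hx : 0 < x) {n : ℕ} (hn : 1 ≤ n) :
    (n : ℝ) ^ (-(1 / 2) : ℝ) * (2 * x / n) ^ ((1 : ℝ) / 6) =
      (2 * x) ^ ((1 : ℝ) / 6) * (n : ℝ) ^ ((1 : ℝ) / 3 - 1) := by
  have hn0 : (0 : ℝ) < n := by exact_mod_cast hn
  rw [Real.div_rpow (by positivity) hn0.le, show (1 : ℝ) / 3 - 1 = -(1 / 2) - 1 / 6 by norm_num,
    Real.rpow_sub hn0]
  ring

/-- The number of `c` counted by the pairs `(n, c)` with `n c⁶ = a`. -/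
noncomputable def fiberCount (x : ℝ) (q : ℕ) (a : ZMod q) (n : ℕ) : ℝ :=
  ((((Finset.Icc 1 ⌊2 * x⌋₊).filter fun c : ℕ => (c : ℝ) ≤ (2 * x / n) ^ ((1 : ℝ) / 6)).filter
    fun c : ℕ => (n : ZMod q) * (c : ZMod q) ^ 6 = a).card : ℝ)

lemma abs_Spair_le_sum_fiberCount {q : ℕ} {x R : ℝ} (hx : 0 < x) (hR : 0 < R)
    (P : ℕ → Prop) (hP : ∀ c, P c → x / R < (c : ℝ) ^ 6) (a : ZMod q) :
    |Spair x q a P| ≤ ∑ n ∈ Finset.Icc 1 ⌊2 * R⌋₊,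
      fmBound * (n : ℝ) ^ (-(1 / 2) : ℝ) * fiberCount x q a n := by
  classical
  unfold Spair
  have hterm : ∀ n ∈ Finset.Icc 1 ⌊2 * x⌋₊, |∑ c ∈ Finset.Icc 1 ⌊2 * x⌋₊,
      (if x < ((n * c ^ 6 : ℕ) : ℝ) ∧ ((n * c ^ 6 : ℕ) : ℝ) ≤ 2 * x ∧ P c ∧
        ((n * c ^ 6 : ℕ) : ZMod q) = a
      then ((ArithmeticFunction.moebius c : ℤ) : ℝ) * fm n else 0)| ≤
      if n ∈ Finset.Icc 1 ⌊2 * R⌋₊ then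
        fmBound * (n : ℝ) ^ (-(1 / 2) : ℝ) * fiberCount x q a n else 0 := by
    intro n hn
    have hn1 := (Finset.mem_Icc.1 hn).1
    have hn0 : (0 : ℝ) < n := by exact_mod_cast hn1
    have hfm0 : 0 ≤ fmBound * (n : ℝ) ^ (-(1 / 2) : ℝ) :=
      mul_nonneg fmBound_nonneg (by positivity)
    refine (Finset.abs_sum_le_sum_abs _ _).trans ?_
    split_ifs with hmem
    · rw [fiberCount, mul_comm (fmBound * _), ← nsmul_eq_mul, ← Finset.sum_const, Finset.filter_filter,
        Finset.sum_filter]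
      refine Finset.sum_le_sum fun c hc => ?_
      by_cases h : x < ((n * c ^ 6 : ℕ) : ℝ) ∧ ((n * c ^ 6 : ℕ) : ℝ) ≤ 2 * x ∧ P c ∧
        ((n * c ^ 6 : ℕ) : ZMod q) = a
      · have h6 : (c : ℝ) ≤ (2 * x / n) ^ ((1 : ℝ) / 6) := by
          refine le_rpow_one_sixth (Nat.cast_nonneg c) ?_
          rw [le_div_iff₀ hn0, mul_comm]
          exact_mod_cast h.2.1
        rw [if_pos h, if_pos ⟨h6, by exact_mod_cast h.2.2.2⟩, abs_mul]
        refine (mul_le_of_le_one_left (abs_nonneg _) ?_).trans (abs_fm_le hn1)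
        exact_mod_cast ArithmeticFunction.abs_moebius_le_one
      · rw [if_neg h, abs_zero]
        split_ifs
        · exact hfm0
        · exact le_rfl
    · refine (Finset.sum_eq_zero fun c hc => ?_).le
      rw [if_neg, abs_zero]
      rintro ⟨_, h2, h3, _⟩
      refine hmem (Finset.mem_Icc.2 ⟨hn1, Nat.le_floor ?_⟩)
      have h4 := hP c h3
      push_cast at h2
      have h5 : (n : ℝ) * (x / R) ≤ 2 * x := (mul_le_mul_of_nonneg_left h4.le hn0.le).trans h2
      rw [← mul_div_assoc, div_le_iff₀ hR] at h5
      exact le_of_mul_le_mul_right (by linarith) hx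
  refine (Finset.abs_sum_le_sum_abs _ _).trans ((Finset.sum_le_sum hterm).trans ?_)
  rw [← Finset.sum_filter]
  refine Finset.sum_le_sum_of_subset_of_nonneg (fun n hn => (Finset.mem_filter.1 hn).2)
    fun n _ _ => ?_
  have := fmBound_nonneg
  unfold fiberCount
  positivity

lemma sum_rpow_le_of_floor {r : ℝ} (hr0 : 0 < r) (hr1 : r ≤ 1) {N : ℝ} (hN : 0 ≤ N) :
    ∑ n ∈ Finset.Icc 1 ⌊N⌋₊, (n : ℝ) ^ (r - 1) ≤ N ^ r / r :=
  (sum_rpow_sub_one_le hr0 hr1 _).trans (by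
    gcongr
    exact Nat.floor_le hN)

/-- Second moment bound for the pairs with `c` large, by counting. -/
lemma sum_sq_Spair_le {q : ℕ} [Fact q.Prime] {x R : ℝ} (hx : 0 < x) (hR : 0 < R)
    (P : ℕ → Prop) (hP : ∀ c, P c → x / R < (c : ℝ) ^ 6) :
    ∑ a : ZMod q with a ≠ 0, (Spair x q a P) ^ 2 ≤
      (6 * fmBound * ((2 * x) ^ ((1 : ℝ) / 6) / q * (3 * (2 * R) ^ ((1 : ℝ) / 3)) +
        2 * (2 * R) ^ ((1 : ℝ) / 2))) *
      (fmBound * ((2 * x) ^ ((1 : ℝ) / 6) * (3 * (2 * R) ^ ((1 : ℝ) / 3)))) := by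
  classical
  have hA := fmBound_nonneg
  set T : ZMod q → ℝ := fun a => ∑ n ∈ Finset.Icc 1 ⌊2 * R⌋₊,
      fmBound * (n : ℝ) ^ (-(1 / 2) : ℝ) * fiberCount x q a n with hT
  have hfc0 : ∀ a n, 0 ≤ fiberCount x q a n := fun a n => Nat.cast_nonneg _
  have hT0 : ∀ a, 0 ≤ T a := fun a => Finset.sum_nonneg fun n _ =>
    mul_nonneg (by positivity) (hfc0 a n)
  have hs13 := sum_rpow_le_of_floor (r := 1 / 3) (by norm_num) (by norm_num)
    (by positivity : 0 ≤ 2 * R)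
  have hs12 := sum_rpow_le_of_floor (r := 1 / 2) (by norm_num) (by norm_num)
    (by positivity : 0 ≤ 2 * R)
  have hpoint : ∀ a : ZMod q, a ≠ 0 → T a ≤
      6 * fmBound * ((2 * x) ^ ((1 : ℝ) / 6) / q * (3 * (2 * R) ^ ((1 : ℝ) / 3)) +
        2 * (2 * R) ^ ((1 : ℝ) / 2)) := by
    intro a ha
    have hcount : ∀ n, fiberCount x q a n ≤ 6 * ((2 * x / n) ^ ((1 : ℝ) / 6) / q + 1) := by
      intro n
      have hy : 0 ≤ (2 * x / n) ^ ((1 : ℝ) / 6) := by positivity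
      unfold fiberCount
      refine card_le_of_pow_six_eq ((n : ZMod q)⁻¹ * a) hy _ fun c hc => ?_
      obtain ⟨hc1, hc2⟩ := Finset.mem_filter.1 hc
      have hn : (n : ZMod q) ≠ 0 := fun h => ha (by rw [← hc2, h, zero_mul])
      exact ⟨(Finset.mem_filter.1 hc1).2, by rw [← hc2, inv_mul_cancel_left₀ hn]⟩
    calc T a ≤ ∑ n ∈ Finset.Icc 1 ⌊2 * R⌋₊, 6 * fmBound *
          ((2 * x) ^ ((1 : ℝ) / 6) / q * (n : ℝ) ^ ((1 : ℝ) / 3 - 1) +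
            (n : ℝ) ^ ((1 : ℝ) / 2 - 1)) := by
          refine Finset.sum_le_sum fun n hn => ?_
          have h1 := rpow_neg_half_mul_rpow_div hx (Finset.mem_Icc.1 hn).1
          calc _ ≤ fmBound * (n : ℝ) ^ (-(1 / 2) : ℝ) *
                (6 * ((2 * x / n) ^ ((1 : ℝ) / 6) / q + 1)) :=
                mul_le_mul_of_nonneg_left (hcount n) (by positivity)
            _ = 6 * fmBound * (((n : ℝ) ^ (-(1 / 2) : ℝ) * (2 * x / n) ^ ((1 : ℝ) / 6)) / q +
                (n : ℝ) ^ (-(1 / 2) : ℝ)) := by ring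
            _ = _ := by
                rw [h1, show (1 : ℝ) / 2 - 1 = -(1 / 2) by norm_num]
                ring
      _ = 6 * fmBound * ((2 * x) ^ ((1 : ℝ) / 6) / q *
            ∑ n ∈ Finset.Icc 1 ⌊2 * R⌋₊, (n : ℝ) ^ ((1 : ℝ) / 3 - 1) +
            ∑ n ∈ Finset.Icc 1 ⌊2 * R⌋₊, (n : ℝ) ^ ((1 : ℝ) / 2 - 1)) := by
          rw [← Finset.mul_sum, Finset.sum_add_distrib, ← Finset.mul_sum]
      _ ≤ 6 * fmBound * ((2 * x) ^ ((1 : ℝ) / 6) / q * ((2 * R) ^ ((1 : ℝ) / 3) / (1 / 3)) +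
            (2 * R) ^ ((1 : ℝ) / 2) / (1 / 2)) := by gcongr
      _ = _ := by ring
  have htotal : ∑ a : ZMod q with a ≠ 0, T a ≤
      fmBound * ((2 * x) ^ ((1 : ℝ) / 6) * (3 * (2 * R) ^ ((1 : ℝ) / 3))) := by
    calc _ ≤ ∑ a : ZMod q, T a :=
          Finset.sum_le_sum_of_subset_of_nonneg (Finset.filter_subset _ _) fun a _ _ => hT0 a
      _ ≤ ∑ n ∈ Finset.Icc 1 ⌊2 * R⌋₊,
          fmBound * ((2 * x) ^ ((1 : ℝ) / 6) * (n : ℝ) ^ ((1 : ℝ) / 3 - 1)) := by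
          rw [Finset.sum_comm]
          refine Finset.sum_le_sum fun n hn => ?_
          have h1 := rpow_neg_half_mul_rpow_div hx (Finset.mem_Icc.1 hn).1
          rw [← Finset.mul_sum, ← h1, mul_assoc]
          refine mul_le_mul_of_nonneg_left (mul_le_mul_of_nonneg_left ?_ (by positivity)) hA
          simp only [fiberCount]
          rw [← Nat.cast_sum, ← Finset.card_eq_sum_card_fiberwise fun c _ => Finset.mem_univ _]
          exact card_le_of_forall_mem_le (by positivity) _ fun c hc =>
            ⟨(Finset.mem_Icc.1 (Finset.mem_filter.1 hc).1).1, (Finset.mem_filter.1 hc).2⟩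
      _ ≤ fmBound * ((2 * x) ^ ((1 : ℝ) / 6) * ((2 * R) ^ ((1 : ℝ) / 3) / (1 / 3))) := by
          rw [← Finset.mul_sum, ← Finset.mul_sum]
          gcongr
      _ = _ := by ring
  calc _ ≤ ∑ a : ZMod q with a ≠ 0, T a ^ 2 := by
        refine Finset.sum_le_sum fun a _ => ?_
        rw [← sq_abs]
        gcongr
        exact abs_Spair_le_sum_fiberCount hx hR P hP a
    _ ≤ _ := sum_sq_le_mul_of_le _ (fun a _ => hT0 a)
        (fun a ha => hpoint a (Finset.mem_filter.1 ha).2) (by positivity) htotal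

lemma sum_coprime_range_eq {q : ℕ} [Fact q.Prime] (g : ZMod q → ℝ) :
    ∑ ℓ ∈ (Finset.range q).filter (fun ℓ => Nat.Coprime ℓ q), g (ℓ : ZMod q) =
      ∑ a : ZMod q with a ≠ 0, g a := by
  have hq : q.Prime := Fact.out
  have hcop : ∀ n : ℕ, Nat.Coprime n q ↔ (n : ZMod q) ≠ 0 := by
    intro n
    rw [Nat.coprime_comm, hq.coprime_iff_not_dvd, Ne, ZMod.natCast_eq_zero_iff]
  refine Finset.sum_nbij' (fun ℓ => (ℓ : ZMod q)) (fun a => a.val) ?_ ?_ ?_ ?_ ?_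
  · intro ℓ hℓ
    simpa using (hcop ℓ).1 (Finset.mem_filter.1 hℓ).2
  · intro a ha
    refine Finset.mem_filter.2 ⟨Finset.mem_range.2 (ZMod.val_lt a), (hcop _).2 ?_⟩
    simpa using ha
  · intro ℓ hℓ
    exact ZMod.val_cast_of_lt (Finset.mem_range.1 (Finset.mem_filter.1 hℓ).1)
  · intro a _
    simp
  · intro ℓ _
    rfl

lemma SpairCop_eq_sum_Spair {q : ℕ} [Fact q.Prime] (x : ℝ) (P : ℕ → Prop) :
    SpairCop x q P = ∑ a : ZMod q with a ≠ 0, Spair x q a P := by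
  have hq : q.Prime := Fact.out
  unfold SpairCop Spair
  symm
  rw [Finset.sum_comm]
  refine Finset.sum_congr rfl fun n _ => ?_
  rw [Finset.sum_comm]
  refine Finset.sum_congr rfl fun c _ => ?_
  have hcop : Nat.Coprime (n * c ^ 6) q ↔ ((n * c ^ 6 : ℕ) : ZMod q) ≠ 0 := by
    rw [Nat.coprime_comm, hq.coprime_iff_not_dvd, Ne, ZMod.natCast_eq_zero_iff]
  by_cases h : x < ((n * c ^ 6 : ℕ) : ℝ) ∧ ((n * c ^ 6 : ℕ) : ℝ) ≤ 2 * x ∧ P c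
  · simp only [h.1, h.2.1, h.2.2, true_and, hcop]
    rw [Finset.sum_ite_eq]
    simp
  · have h1 : ∀ Q : Prop, ¬ (x < ((n * c ^ 6 : ℕ) : ℝ) ∧ ((n * c ^ 6 : ℕ) : ℝ) ≤ 2 * x ∧
        P c ∧ Q) := fun Q hQ => h ⟨hQ.1, hQ.2.1, hQ.2.2.1⟩
    simp only [h1, if_false, Finset.sum_const_zero]

lemma Spair_eq_add (x : ℝ) (q : ℕ) (a : ZMod q) (P Q : ℕ → Prop) :
    Spair x q a P = Spair x q a (fun c => P c ∧ Q c) + Spair x q a (fun c => P c ∧ ¬ Q c) := by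
  unfold Spair
  simp only [← Finset.sum_add_distrib]
  refine Finset.sum_congr rfl fun n _ => Finset.sum_congr rfl fun c _ => ?_
  by_cases hQ : Q c <;> simp [hQ]

/-- Averaging over `a` and `α a` does not increase the variance, and the variance is at most the
second moment about any point. -/
lemma sum_sq_average_sub_mean_le {q : ℕ} [Fact q.Prime] (S S₁ S₂ : ZMod q → ℝ)
    (hS : ∀ a, S a = S₁ a + S₂ a) (k : ℝ) {α : ZMod q} (hα : α ≠ 0) :
    ∑ a : ZMod q with a ≠ 0, |1 / 2 * (S a + S (α * a)) -
        1 / (q.totient : ℝ) * ∑ b : ZMod q with b ≠ 0, S b| ^ 2 ≤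
      2 * ∑ a : ZMod q with a ≠ 0, (S₁ a - k) ^ 2 + 2 * ∑ a : ZMod q with a ≠ 0, S₂ a ^ 2 := by
  have hq : q.Prime := Fact.out
  set m := 1 / (q.totient : ℝ) * ∑ b : ZMod q with b ≠ 0, S b with hm
  have hφ : (0 : ℝ) < q.totient := by exact_mod_cast Nat.totient_pos.2 hq.pos
  have hcard : ((Finset.univ.filter fun a : ZMod q => a ≠ 0).card : ℝ) = q.totient := by
    rw [Nat.totient_prime hq, Finset.filter_ne', Finset.card_erase_of_mem (Finset.mem_univ _),
      Finset.card_univ, ZMod.card]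
  have hperm : ∑ a : ZMod q with a ≠ 0, (S (α * a) - m) ^ 2 =
      ∑ a : ZMod q with a ≠ 0, (S a - m) ^ 2 := by
    refine Finset.sum_nbij' (fun a => α * a) (fun a => α⁻¹ * a) ?_ ?_ ?_ ?_ ?_
    · intro a ha; simpa [hα] using ha
    · intro a ha; simpa [hα] using ha
    · intro a _; exact inv_mul_cancel_left₀ hα a
    · intro a _; exact mul_inv_cancel_left₀ hα a
    · intro a _; rfl
  have hmean : ∑ a : ZMod q with a ≠ 0, (S a - m) ^ 2 ≤
      ∑ a : ZMod q with a ≠ 0, (S a - k) ^ 2 := by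
    have h1 : ∑ a : ZMod q with a ≠ 0, (S a - m) = 0 := by
      rw [Finset.sum_sub_distrib, Finset.sum_const, nsmul_eq_mul, hcard, hm]
      field_simp
      ring
    have h2 : ∑ a : ZMod q with a ≠ 0, (S a - k) ^ 2 =
        ∑ a : ZMod q with a ≠ 0, (S a - m) ^ 2 +
          (2 * (m - k) * ∑ a : ZMod q with a ≠ 0, (S a - m) +
            ∑ _a : ZMod q with _a ≠ 0, (m - k) ^ 2) := by
      rw [Finset.mul_sum, ← Finset.sum_add_distrib, ← Finset.sum_add_distrib]
      exact Finset.sum_congr rfl fun a _ => by ring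
    rw [h2, h1, mul_zero, zero_add]
    exact le_add_of_nonneg_right (Finset.sum_nonneg fun _ _ => sq_nonneg _)
  calc _ ≤ ∑ a : ZMod q with a ≠ 0, (1 / 2 * (S a - m) ^ 2 + 1 / 2 * (S (α * a) - m) ^ 2) := by
        refine Finset.sum_le_sum fun a _ => ?_
        rw [sq_abs]
        nlinarith [sq_nonneg (S a - S (α * a))]
    _ = ∑ a : ZMod q with a ≠ 0, (S a - m) ^ 2 := by
        rw [Finset.sum_add_distrib, ← Finset.mul_sum, ← Finset.mul_sum, hperm]
        ring
    _ ≤ ∑ a : ZMod q with a ≠ 0, (S a - k) ^ 2 := hmean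
    _ ≤ ∑ a : ZMod q with a ≠ 0, (2 * (S₁ a - k) ^ 2 + 2 * S₂ a ^ 2) := by
        refine Finset.sum_le_sum fun a _ => ?_
        rw [hS a]
        nlinarith [sq_nonneg (S₁ a - k - S₂ a)]
    _ = _ := by rw [Finset.sum_add_distrib, Finset.mul_sum, Finset.mul_sum]

lemma div_le_rpow_of_rpow_le {x q ε : ℝ} (hε0 : 0 < ε) (hε1 : ε < 1 / 1000) (hx : 0 < x)
    (hq : 1 ≤ q) (h : x ^ ((1 : ℝ) / 9 + ε) ≤ q) : x / q ≤ q ^ (8 - 9 * ε) := by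
  have hq0 : 0 < q := by linarith
  have h1 : x ≤ q ^ (9 - 9 * ε) := by
    have hpos : 0 < (1 : ℝ) / 9 + ε := by linarith
    calc x = (x ^ ((1 : ℝ) / 9 + ε)) ^ ((1 : ℝ) / 9 + ε)⁻¹ := by
          rw [← Real.rpow_mul hx.le, mul_inv_cancel₀ hpos.ne', Real.rpow_one]
      _ ≤ q ^ ((1 : ℝ) / 9 + ε)⁻¹ := Real.rpow_le_rpow (by positivity) h (by positivity)
      _ ≤ q ^ (9 - 9 * ε) := by
          refine Real.rpow_le_rpow_of_exponent_le hq ?_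
          rw [inv_le_iff_one_le_mul₀ hpos]
          nlinarith
  rw [div_le_iff₀ hq0, ← Real.rpow_add_one hq0.ne']
  rwa [show 8 - 9 * ε + 1 = 9 - 9 * ε by ring]

lemma one_add_log_sq_le {q ε : ℝ} (hε0 : 0 < ε) (hq : 1 ≤ q) :
    (1 + Real.log q) ^ 2 ≤ (1 + 2 / ε) ^ 2 * q ^ ε := by
  have h1 := Real.log_le_rpow_div (x := q) (by linarith) (half_pos hε0)
  have h2 : 1 ≤ q ^ (ε / 2) := Real.one_le_rpow hq (by positivity)
  have h3 : 1 + Real.log q ≤ (1 + 2 / ε) * q ^ (ε / 2) := by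
    have : q ^ (ε / 2) / (ε / 2) = 2 / ε * q ^ (ε / 2) := by field_simp
    rw [this] at h1
    linarith
  have h4 : q ^ ε = (q ^ (ε / 2)) ^ 2 := by
    rw [← Real.rpow_natCast, ← Real.rpow_mul (by linarith)]; norm_num
  rw [h4, ← mul_pow]
  exact pow_le_pow_left₀ (by linarith [Real.log_nonneg hq]) h3 2

lemma rpow_bound_of_le {X q ε : ℝ} (hε0 : 0 < ε) (hε1 : ε < 1 / 1000) (hX : 0 < X)
    (hq : 1 ≤ q) (h : X ≤ q ^ (8 - 9 * ε)) :
    q ^ ε * (X ^ ((1 : ℝ) / 3) * q ^ (-(4 / 3) : ℝ) + X ^ ((1 : ℝ) / 6) * q ^ (-(5 / 12) : ℝ)) ≤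
      2 * X ^ ((1 : ℝ) / 6 - ε / 16) := by
  have hq0 : 0 < q := by linarith
  have key : ∀ s t : ℝ, 0 ≤ s → ε + (8 - 9 * ε) * s + t ≤ 0 → q ^ ε * (X ^ s * q ^ t) ≤ 1 := by
    intro s t hs hst
    calc q ^ ε * (X ^ s * q ^ t) ≤ q ^ ε * ((q ^ (8 - 9 * ε)) ^ s * q ^ t) := by gcongr
      _ = q ^ (ε + (8 - 9 * ε) * s + t) := by
          rw [← Real.rpow_mul hq0.le, ← Real.rpow_add hq0, ← Real.rpow_add hq0, add_assoc]
      _ ≤ 1 := Real.rpow_le_one_of_one_le_of_nonpos hq hst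
  have e1 : X ^ ((1 : ℝ) / 3) = X ^ ((1 : ℝ) / 6 - ε / 16) * X ^ ((1 : ℝ) / 6 + ε / 16) := by
    rw [← Real.rpow_add hX]; congr 1; ring
  have e2 : X ^ ((1 : ℝ) / 6) = X ^ ((1 : ℝ) / 6 - ε / 16) * X ^ (ε / 16) := by
    rw [← Real.rpow_add hX]; congr 1; ring
  have k1 := key (1 / 6 + ε / 16) (-(4 / 3)) (by positivity) (by nlinarith)
  have k2 := key (ε / 16) (-(5 / 12)) (by positivity) (by nlinarith)
  rw [e1, e2]
  have hW : 0 ≤ X ^ ((1 : ℝ) / 6 - ε / 16) := by positivity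
  nlinarith [mul_le_mul_of_nonneg_left k1 hW, mul_le_mul_of_nonneg_left k2 hW]

lemma exists_sum_sq_bounds {q : ℕ} [Fact q.Prime] {x : ℝ} (hx : 0 < x) (P : ℕ → Prop) :
    ∃ k : ℝ,
      (∑ a : ZMod q with a ≠ 0,
        (Spair x q a (fun c => P c ∧ (c : ℝ) ^ 6 ≤ x / (q : ℝ) ^ ((1 : ℝ) / 2)) - k) ^ 2 ≤
        q * (24 * fmBound ^ 2 * (1 + Real.log q) ^ 2 *
          ((x / q) ^ ((1 : ℝ) / 3) * (q : ℝ) ^ (-(4 / 3) : ℝ) +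
            (x / q) ^ ((1 : ℝ) / 6) * (q : ℝ) ^ (-(5 / 12) : ℝ)))) ∧
      ∑ a : ZMod q with a ≠ 0,
        (Spair x q a (fun c => P c ∧ ¬ (c : ℝ) ^ 6 ≤ x / (q : ℝ) ^ ((1 : ℝ) / 2))) ^ 2 ≤
        q * (864 * fmBound ^ 2 *
          ((x / q) ^ ((1 : ℝ) / 3) * (q : ℝ) ^ (-(4 / 3) : ℝ) +
            (x / q) ^ ((1 : ℝ) / 6) * (q : ℝ) ^ (-(5 / 12) : ℝ))) := by
  have hq : (0 : ℝ) < q := by exact_mod_cast (Fact.out : q.Prime).pos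
  have hA := fmBound_nonneg
  set p : ℝ := (q : ℝ) ^ ((1 : ℝ) / 12) with hp
  set u : ℝ := (x / q) ^ ((1 : ℝ) / 6) with hu
  have hp0 : 0 < p := by positivity
  have hu0 : 0 < u := by positivity
  have hqp : ∀ k : ℕ, (q : ℝ) ^ ((k : ℝ) / 12) = p ^ k := by
    intro k
    rw [hp, ← Real.rpow_natCast, ← Real.rpow_mul hq.le]; congr 1; ring
  have hq12 : (q : ℝ) = p ^ 12 := by rw [← hqp 12]; norm_num
  have hR : (q : ℝ) ^ ((1 : ℝ) / 2) = p ^ 6 := by rw [← hqp 6]; norm_num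
  have hq43 : (q : ℝ) ^ (-(4 / 3) : ℝ) = (p ^ 16)⁻¹ := by
    rw [Real.rpow_neg hq.le, ← hqp 16]; norm_num
  have hq512 : (q : ℝ) ^ (-(5 / 12) : ℝ) = (p ^ 5)⁻¹ := by
    rw [Real.rpow_neg hq.le, ← hqp 5]; norm_num
  have hX3 : (x / q) ^ ((1 : ℝ) / 3) = u ^ 2 := by
    rw [hu, ← Real.rpow_natCast, ← Real.rpow_mul (by positivity)]; norm_num
  have hroot : ∀ t : ℝ, 0 ≤ t → (t ^ 6) ^ ((1 : ℝ) / 6) = t := by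
    intro t ht
    rw [← Real.rpow_natCast, ← Real.rpow_mul ht]; norm_num
  have hx6 : x = (u * p ^ 2) ^ 6 := by
    have h1 : u ^ 6 = x / q := by
      rw [hu, ← Real.rpow_natCast, ← Real.rpow_mul (by positivity)]; norm_num
    have h2 : x = u ^ 6 * p ^ 12 := by rw [h1, ← hq12]; field_simp
    rw [h2]; ring
  have hY : (x / p ^ 6) ^ ((1 : ℝ) / 6) = u * p := by
    have h1 : x / p ^ 6 = (u * p) ^ 6 := by rw [hx6]; field_simp
    rw [h1, hroot _ (by positivity)]
  have h2x : (2 * x) ^ ((1 : ℝ) / 6) ≤ 2 * (u * p ^ 2) := by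
    calc (2 * x) ^ ((1 : ℝ) / 6) ≤ ((2 * (u * p ^ 2)) ^ 6) ^ ((1 : ℝ) / 6) := by
          refine Real.rpow_le_rpow (by positivity) ?_ (by norm_num)
          rw [mul_pow, ← hx6]
          linarith
      _ = _ := hroot _ (by positivity)
  have h2R3 : (2 * p ^ 6) ^ ((1 : ℝ) / 3) ≤ 2 * p ^ 2 := by
    calc (2 * p ^ 6) ^ ((1 : ℝ) / 3) ≤ ((2 * p ^ 2) ^ 3) ^ ((1 : ℝ) / 3) := by
          refine Real.rpow_le_rpow (by positivity) ?_ (by norm_num)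
          nlinarith [pow_pos hp0 6]
      _ = _ := by
          rw [← Real.rpow_natCast, ← Real.rpow_mul (by positivity)]; norm_num
  have h2R2 : (2 * p ^ 6) ^ ((1 : ℝ) / 2) ≤ 2 * p ^ 3 := by
    calc (2 * p ^ 6) ^ ((1 : ℝ) / 2) ≤ ((2 * p ^ 3) ^ 2) ^ ((1 : ℝ) / 2) := by
          refine Real.rpow_le_rpow (by positivity) ?_ (by norm_num)
          nlinarith [pow_pos hp0 6]
      _ = _ := by
          rw [← Real.rpow_natCast, ← Real.rpow_mul (by positivity)]; norm_num
  rw [hR, hq43, hq512, hX3]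
  obtain ⟨k, hk⟩ := exists_sum_sq_Spair_sub_le (q := q) hx (pow_pos hp0 6)
    (fun c => P c ∧ (c : ℝ) ^ 6 ≤ x / p ^ 6) (fun c hc => hc.2)
  refine ⟨k, hk.trans (le_of_eq ?_), ?_⟩
  · rw [hY]
    set L := (1 + Real.log q) ^ 2
    rw [hq12]
    field_simp
  · refine (sum_sq_Spair_le hx (pow_pos hp0 6) _ fun c hc => not_le.1 hc.2).trans ?_
    calc _ ≤ (6 * fmBound * ((2 * (u * p ^ 2)) / q * (3 * (2 * p ^ 2)) + 2 * (2 * p ^ 3))) *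
          (fmBound * ((2 * (u * p ^ 2)) * (3 * (2 * p ^ 2)))) := by gcongr
      _ ≤ _ := by
          rw [hq12]
          have h1 : 0 ≤ fmBound ^ 2 * u * p ^ 7 := by positivity
          have e1 : (6 * fmBound * ((2 * (u * p ^ 2)) / p ^ 12 * (3 * (2 * p ^ 2)) +
              2 * (2 * p ^ 3))) * (fmBound * ((2 * (u * p ^ 2)) * (3 * (2 * p ^ 2)))) =
              864 * fmBound ^ 2 * u ^ 2 / p ^ 4 + 288 * (fmBound ^ 2 * u * p ^ 7) := by
            field_simp
            ring
          have e2 : p ^ 12 * (864 * fmBound ^ 2 * (u ^ 2 * (p ^ 16)⁻¹ + u * (p ^ 5)⁻¹)) =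
              864 * fmBound ^ 2 * u ^ 2 / p ^ 4 + 864 * (fmBound ^ 2 * u * p ^ 7) := by
            field_simp
          rw [e1, e2]
          linarith

theorem stmt11 (ε : ℝ) (hε : ε ∈ Set.Ioo (0:ℝ) (1/1000)) :
    ∃ C : ℝ, 0 < C ∧ ∀ x : ℝ, 2 ≤ x → ∀ q : ℕ, q.Prime →
      x ^ ((1:ℝ)/9 + ε) ≤ (q:ℝ) → (q:ℝ) ≤ x →
      ∀ z : ℝ, (x/(q:ℝ)) ^ (1 + ε) ≤ z →
      ∀ α : ℕ, ¬ IsSquare ((α : ZMod q)) →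
      (1 / (q.totient : ℝ)) *
          (∑ ℓ ∈ (Finset.range q).filter (fun ℓ => Nat.Coprime ℓ q),
            |(1/2) * (Spair x q ((ℓ : ℕ) : ZMod q) (fun c => z < ((c:ℝ))^6) +
                      Spair x q ((α * ℓ : ℕ) : ZMod q) (fun c => z < ((c:ℝ))^6)) -
              (1 / (q.totient : ℝ)) * SpairCop x q (fun c => z < ((c:ℝ))^6)| ^ 2)
      ≤ C * (x/(q:ℝ)) ^ ((1:ℝ)/6 - ε/16) := by
  obtain ⟨hε0, hε1⟩ := hε
  have hA := fmBound_nonneg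
  refine ⟨7104 * fmBound ^ 2 * (1 + 2 / ε) ^ 2 + 1, by positivity, ?_⟩
  intro x hx q hq hxq _ z _ α hα
  have : Fact q.Prime := ⟨hq⟩
  have hx0 : 0 < x := by linarith
  have hq2 : (2 : ℝ) ≤ q := by exact_mod_cast hq.two_le
  have hq0 : (0 : ℝ) < q := by linarith
  have hα0 : (α : ZMod q) ≠ 0 := fun h => hα (h ▸ IsSquare.zero)
  set P : ℕ → Prop := fun c => z < (c : ℝ) ^ 6 with hP
  obtain ⟨k, h1, h2⟩ := exists_sum_sq_bounds (q := q) hx0 P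
  set E := (x / q) ^ ((1 : ℝ) / 3) * (q : ℝ) ^ (-(4 / 3) : ℝ) +
    (x / q) ^ ((1 : ℝ) / 6) * (q : ℝ) ^ (-(5 / 12) : ℝ) with hE
  have hE0 : 0 ≤ E := by positivity
  have hsum := sum_coprime_range_eq (q := q) fun a => |(1 / 2) * (Spair x q a P +
    Spair x q ((α : ZMod q) * a) P) - (1 / (q.totient : ℝ)) * SpairCop x q P| ^ 2
  push_cast
  rw [hsum, SpairCop_eq_sum_Spair]
  have hvar := sum_sq_average_sub_mean_le (fun a => Spair x q a P) _ _
    (fun a => Spair_eq_add x q a P fun c => (c : ℝ) ^ 6 ≤ x / (q : ℝ) ^ ((1 : ℝ) / 2)) k hα0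
  have hφ : 1 / (q.totient : ℝ) ≤ 2 / q := by
    rw [Nat.totient_prime hq, Nat.cast_sub hq.one_le, Nat.cast_one,
      div_le_div_iff₀ (by linarith) hq0]
    linarith
  have hL : 1 ≤ (1 + Real.log q) ^ 2 :=
    one_le_pow₀ (by linarith [Real.log_natCast_nonneg q])
  have hW : 0 ≤ (x / (q : ℝ)) ^ ((1 : ℝ) / 6 - ε / 16) := by positivity
  calc _ ≤ 2 / (q : ℝ) * (2 * (q * (24 * fmBound ^ 2 * (1 + Real.log q) ^ 2 * E)) +
        2 * (q * (864 * fmBound ^ 2 * E))) := by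
        refine mul_le_mul hφ (hvar.trans (by linarith)) ?_ (by positivity)
        exact Finset.sum_nonneg fun _ _ => by positivity
    _ = 96 * (fmBound ^ 2 * E * (1 + Real.log q) ^ 2) + 3456 * (fmBound ^ 2 * E * 1) := by
        field_simp
        ring
    _ ≤ 96 * (fmBound ^ 2 * E * (1 + Real.log q) ^ 2) +
        3456 * (fmBound ^ 2 * E * (1 + Real.log q) ^ 2) := by gcongr
    _ = 3552 * fmBound ^ 2 * ((1 + Real.log q) ^ 2 * E) := by ring
    _ ≤ 3552 * fmBound ^ 2 * (((1 + 2 / ε) ^ 2 * (q : ℝ) ^ ε) * E) := by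
        gcongr
        exact one_add_log_sq_le hε0 (by linarith)
    _ = 3552 * fmBound ^ 2 * (1 + 2 / ε) ^ 2 * ((q : ℝ) ^ ε * E) := by ring
    _ ≤ 3552 * fmBound ^ 2 * (1 + 2 / ε) ^ 2 *
        (2 * (x / (q : ℝ)) ^ ((1 : ℝ) / 6 - ε / 16)) := by
        refine mul_le_mul_of_nonneg_left ?_ (by positivity)
        exact rpow_bound_of_le hε0 hε1 (by positivity) (by linarith)
          (div_le_rpow_of_rpow_le hε0 hε1 hx0 (by linarith) hxq)
    _ ≤ _ := by linarith
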